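/- There exists an infinite binary word w that is (7/3)⁺-free such that there is no binary word x with |x| ≥ 13 for which both x and its complement x̄ are factors of w. -/

import Mathlib

/-- `x` occurs as a contiguous block in the infinite word `w : ℕ → α`. -/
def FactorN {α : Type*} (w : ℕ → α) (x : List α) : Prop :=
  ∃ i : ℕ, x = (List.range x.length).map fun k => w (i + k)

/-- the finite word `u` has period `p ≥ 1`. -/
def HasPeriod {α : Type*} (u : List α) (p : ℕ) : Prop :=
  1 ≤ p ∧ ∀ i : ℕ, i + p < u.length → u[i]? = u[i + p]?

/-- the smallest period of `u`. -/
noncomputable def minPeriod {α : Type*} (u : List α) : ℕ :=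
  sInf {p | HasPeriod u p}

/-- the exponent of `u`: its length divided by its smallest period. -/
noncomputable def expo {α : Type*} (u : List α) : ℝ :=
  (u.length : ℝ) / (minPeriod u : ℝ)

/-- the complement of a binary word: each letter is flipped. -/
def comp (x : List Bool) : List Bool := x.map fun b => !b

/-- The image of the infinite word `s` under the `q`-uniform morphism sending the letter `a` to the
block `h a 0, …, h a (q - 1)`. -/
def uniformImage {α β : Type*} (h : α → ℕ → β) (q : ℕ) (s : ℕ → α) (n : ℕ) : β :=
  h (s (n / q)) (n % q)

theorem uniformImage_mul_add {α β : Type*} (h : α → ℕ → β) {q : ℕ} (hq : 0 < q) (s : ℕ → α)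
    (b n : ℕ) : uniformImage h q s (q * b + n) = h (s (b + n / q)) (n % q) := by
  rw [uniformImage, Nat.mul_add_div hq, Nat.mul_add_mod]

/-- If no block `h a` occurs properly inside a product of two blocks with distinct letters, then a
long agreement between an image word and its shift by `p` forces `q ∣ p`. -/
theorem dvd_of_uniformImage_eq_shift {α β : Type*} {h : α → ℕ → β} {q : ℕ} (hq : 0 < q)
    (hsync : ∀ a b c, b ≠ c → ∀ r < q, 0 < r →
      ∃ k < q, h a k ≠ if r + k < q then h b (r + k) else h c (r + k - q))
    {s : ℕ → α} (hs : ∀ i, s i ≠ s (i + 1)) {i p m : ℕ} (hm : 2 * q - 1 ≤ m)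
    (hrun : ∀ k < m, uniformImage h q s (i + k) = uniformImage h q s (i + k + p)) : q ∣ p := by
  by_contra hp
  have hr : 0 < p % q := Nat.pos_of_ne_zero fun h0 => hp (Nat.dvd_of_mod_eq_zero h0)
  set t := (i + q - 1) / q with ht
  have h1 := Nat.div_add_mod (i + q - 1) q
  have h2 := Nat.mod_lt (i + q - 1) hq
  have h3 := Nat.div_add_mod p q
  have h4 := Nat.mod_lt p hq
  rw [← ht] at h1
  obtain ⟨k, hk, hne⟩ := hsync (s t) (s (t + p / q)) (s (t + p / q + 1)) (hs _) (p % q) h4 hr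
  apply hne
  have key := hrun (q * t + k - i) (by omega)
  have e1 : i + (q * t + k - i) = q * t + k := by omega
  have e2 : q * t + k + p = q * (t + p / q) + (p % q + k) := by rw [mul_add]; omega
  rw [e1, e2, uniformImage_mul_add h hq, uniformImage_mul_add h hq, Nat.div_eq_of_lt hk,
    Nat.mod_eq_of_lt hk, Nat.add_zero] at key
  rw [key]
  split_ifs with hlt
  · rw [Nat.div_eq_of_lt hlt, Nat.mod_eq_of_lt hlt, Nat.add_zero]
  · have e3 : p % q + k = (p % q + k - q) + q := by omega
    have e4 : p % q + k - q < q := by omega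
    have e5 : (p % q + k) / q = 1 := by
      rw [e3, Nat.add_div_right _ hq, Nat.div_eq_of_lt e4]
    have e6 : (p % q + k) % q = p % q + k - q := by
      conv_lhs => rw [e3, Nat.add_mod_right, Nat.mod_eq_of_lt e4]
    rw [e5, e6]

/-- An infinite word without nonempty squares. -/
def SquareFreeWord {α : Type*} (s : ℕ → α) : Prop :=
  ∀ p, 0 < p → ∀ i, ∃ k < p, s (i + k) ≠ s (i + k + p)

theorem SquareFreeWord.ne_succ {α : Type*} {s : ℕ → α} (hs : SquareFreeWord s) (i : ℕ) :
    s i ≠ s (i + 1) := by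
  obtain ⟨k, hk, hne⟩ := hs 1 one_pos i
  obtain rfl : k = 0 := by omega
  exact hne

/-- The image of the letter `0` under Leech's square-free morphism. -/
def leechDigit (n : ℕ) : Fin 3 :=
  [0, 1, 2, 1, 0, 2, 1, 2, 0, 1, 2, 1, 0].getD n 0

/-- Leech's 13-uniform square-free morphism on three letters. -/
def leechMorphism (a : Fin 3) (n : ℕ) : Fin 3 :=
  a + leechDigit n

/-- The fixed point of `leechMorphism` starting with `0`. -/
def leechWord (n : ℕ) : Fin 3 :=
  ((Nat.digits 13 n).map leechDigit).sum

theorem leechWord_eq_uniformImage (n : ℕ) :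
    leechWord n = uniformImage leechMorphism 13 leechWord n := by
  rcases Nat.eq_zero_or_pos n with rfl | hn
  · decide
  · rw [uniformImage, leechMorphism, leechWord, Nat.digits_def' (by norm_num) hn, List.map_cons,
      List.sum_cons, add_comm, leechWord]

theorem leechWord_mul_add (b n : ℕ) :
    leechWord (13 * b + n) = leechWord (b + n / 13) + leechDigit (n % 13) := by
  rw [leechWord_eq_uniformImage, uniformImage_mul_add _ (by norm_num), leechMorphism]

theorem leechMorphism_sync : ∀ a b c : Fin 3, b ≠ c → ∀ r < 13, 0 < r →
    ∃ k < 13, leechMorphism a k ≠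
      if r + k < 13 then leechMorphism b (r + k) else leechMorphism c (r + k - 13) := by
  decide +kernel

theorem leechDigit_ne_succ : ∀ r < 12, leechDigit r ≠ leechDigit (r + 1) := by
  decide

theorem leechWord_ne_succ (i : ℕ) : leechWord i ≠ leechWord (i + 1) := by
  induction i using Nat.strong_induction_on with
  | _ i ih =>
    have hi := Nat.div_add_mod i 13
    have hlt := Nat.mod_lt i (show 0 < 13 by norm_num)
    rw [← hi, add_assoc, leechWord_mul_add, leechWord_mul_add]
    generalize i / 13 = b at *
    generalize i % 13 = r at *
    rcases Nat.lt_or_ge r 12 with hr | hr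
    · rw [Nat.div_eq_of_lt hlt, Nat.mod_eq_of_lt hlt, Nat.div_eq_of_lt (by omega : r + 1 < 13),
        Nat.mod_eq_of_lt (by omega : r + 1 < 13)]
      exact fun h => leechDigit_ne_succ r hr (add_left_cancel h)
    · obtain rfl : r = 12 := by omega
      simpa [leechDigit] using ih b (by omega)

theorem leechMorphism_no_short_square : ∀ b : Fin 3, 0 ≠ b → ∀ c, b ≠ c → ∀ d, c ≠ d →
    ∀ e, d ≠ e → ∀ p < 25, 0 < p → ∀ r < 13, ∃ k < p,
      leechMorphism ([0, b, c, d, e].getD ((r + k) / 13) 0) ((r + k) % 13) ≠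
      leechMorphism ([0, b, c, d, e].getD ((r + k + p) / 13) 0) ((r + k + p) % 13) := by
  decide +kernel

theorem leechWord_squareFree : SquareFreeWord leechWord := by
  intro p
  induction p using Nat.strong_induction_on with
  | _ p ih =>
    intro hp i
    by_contra! hrun
    rcases Nat.lt_or_ge p 25 with hlt | hge
    · set b := i / 13 with hb
      have hi := Nat.div_add_mod i 13
      rw [← hb] at hi
      have hr := Nat.mod_lt i (show 0 < 13 by norm_num)
      have hdiff (j : ℕ) : leechWord (b + j) - leechWord b ≠ leechWord (b + (j + 1)) - leechWord b :=
        fun h => leechWord_ne_succ (b + j) (sub_left_injective h)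
      obtain ⟨k, hk, hne⟩ := leechMorphism_no_short_square (leechWord (b + 1) - leechWord b)
        (by simpa using hdiff 0) _ (hdiff 1) _ (hdiff 2) _ (hdiff 3) p hlt hp (i % 13) hr
      have hget : ∀ n < 65, leechMorphism ([0, leechWord (b + 1) - leechWord b,
          leechWord (b + 2) - leechWord b, leechWord (b + 3) - leechWord b,
          leechWord (b + 4) - leechWord b].getD (n / 13) 0) (n % 13) =
          leechWord (13 * b + n) - leechWord b := by
        intro n hn
        rw [leechWord_mul_add, leechMorphism]
        have : n / 13 < 5 := by omega
        generalize n / 13 = j at *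
        interval_cases j <;> simp [add_sub_right_comm]
      apply hne
      rw [hget _ (by omega), hget _ (by omega), ← add_assoc, ← add_assoc, ← add_assoc, hi,
        hrun k hk]
    · obtain ⟨d, rfl⟩ : 13 ∣ p := by
        refine dvd_of_uniformImage_eq_shift (i := i) (by norm_num) leechMorphism_sync
          leechWord_ne_succ hge ?_
        simpa only [← leechWord_eq_uniformImage] using hrun
      obtain ⟨j, hj, hne⟩ := ih d (by omega) (by omega) (i / 13)
      apply hne
      have key := hrun (13 * j) (by omega)
      have hi := Nat.div_add_mod i 13
      rw [show i + 13 * j = 13 * (i / 13 + j) + i % 13 by omega,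
        show 13 * (i / 13 + j) + i % 13 + 13 * d = 13 * (i / 13 + j + d) + i % 13 by omega,
        leechWord_mul_add, leechWord_mul_add] at key
      have h0 : i % 13 / 13 = 0 := by omega
      rw [h0] at key
      exact add_right_cancel key

/-- The three binary blocks of length 62, written as numbers with the least significant bit
first. -/
def blockCode : Fin 3 → ℕ
  | 0 => 3797899691263105636
  | 1 => 3797882157679876708
  | 2 => 3797899694069930596

/-- The 62-uniform morphism from three letters to two letters. -/
def blockMorphism (a : Fin 3) (n : ℕ) : Bool :=
  (blockCode a).testBit n

/-- The concatenation of blocks, as a number with the least significant bit first. -/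
def blockListCode (l : List (Fin 3)) : ℕ :=
  l.foldr (fun a E => 2 ^ 62 * E + blockCode a) 0

theorem blockCode_lt : ∀ a, blockCode a < 2 ^ 62 := by
  decide

theorem testBit_blockListCode (s : ℕ → Fin 3) (c : ℕ) : ∀ b n, n < 62 * c →
    (blockListCode ((List.range' b c).map s)).testBit n =
      uniformImage blockMorphism 62 s (62 * b + n) := by
  induction c with
  | zero => intro b n hn; omega
  | succ c ih =>
    intro b n hn
    rw [List.range'_succ, List.map_cons, blockListCode, List.foldr_cons, ← blockListCode,
      Nat.testBit_two_pow_mul_add _ (blockCode_lt _)]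
    split_ifs with hlt
    · rw [uniformImage_mul_add _ (by norm_num), Nat.div_eq_of_lt hlt, Nat.mod_eq_of_lt hlt,
        Nat.add_zero, blockMorphism]
    · rw [ih (b + 1) (n - 62) (by omega)]
      congr 1
      omega

theorem blockListCode_sync : ∀ a b c : Fin 3, b ≠ c → ∀ r < 62, 0 < r →
    blockListCode [b, c] >>> r % 2 ^ 62 ≠ blockCode a := by
  decide +kernel

theorem blockMorphism_sync (a b c : Fin 3) (hbc : b ≠ c) (r : ℕ) (hr : r < 62) (hr0 : 0 < r) :
    ∃ k < 62, blockMorphism a k ≠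
      if r + k < 62 then blockMorphism b (r + k) else blockMorphism c (r + k - 62) := by
  by_contra! hall
  refine blockListCode_sync a b c hbc r hr hr0 (Nat.eq_of_testBit_eq fun k => ?_)
  rw [Nat.testBit_mod_two_pow]
  by_cases hk : k < 62
  · have := hall k hk
    simp only [blockMorphism] at this
    rw [this, Nat.testBit_shiftRight, blockListCode, List.foldr_cons, List.foldr_cons,
      List.foldr_nil, Nat.testBit_two_pow_mul_add _ (blockCode_lt _), mul_zero, zero_add]
    simp [hk]
  · rw [decide_eq_false hk, Bool.false_and, Nat.testBit_lt_two_pow]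
    exact (blockCode_lt a).trans_le (Nat.pow_le_pow_right (by norm_num) (by omega))

theorem blockCode_injective : Function.Injective blockCode := by
  decide

theorem blockMorphism_injective {a b : Fin 3}
    (hab : ∀ k < 62, blockMorphism a k = blockMorphism b k) : a = b := by
  refine blockCode_injective (Nat.eq_of_testBit_eq fun k => ?_)
  by_cases hk : k < 62
  · exact hab k hk
  · have hle : 2 ^ 62 ≤ 2 ^ k := Nat.pow_le_pow_right (by norm_num) (by omega)
    rw [Nat.testBit_lt_two_pow ((blockCode_lt a).trans_le hle),
      Nat.testBit_lt_two_pow ((blockCode_lt b).trans_le hle)]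

/-- Bit `i` of `spreadBits X j` is the disjunction of the bits `i, …, i + 2 ^ j - 1` of `X`. -/
def spreadBits (X : ℕ) : ℕ → ℕ
  | 0 => X
  | j + 1 => spreadBits X j ||| spreadBits X j >>> 2 ^ j

/-- Bit `i` of `windowOr X m` is the disjunction of the bits `i, …, i + m - 1` of `X`. -/
def windowOr (X m : ℕ) : ℕ :=
  spreadBits X (Nat.log2 m) ||| spreadBits X (Nat.log2 m) >>> (m - 2 ^ Nat.log2 m)

theorem testBit_spreadBits_eq_false {X : ℕ} (j : ℕ) : ∀ i,
    (∀ k < 2 ^ j, X.testBit (i + k) = false) → (spreadBits X j).testBit i = false := by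
  induction j with
  | zero => intro i h; simpa [spreadBits] using h 0 (by norm_num)
  | succ j ih =>
    intro i h
    rw [spreadBits, Nat.testBit_or, Nat.testBit_shiftRight, ih i, ih (2 ^ j + i), Bool.or_self]
    · intro k hk
      rw [show 2 ^ j + i + k = i + (2 ^ j + k) by omega]
      exact h _ (by rw [pow_succ]; omega)
    · exact fun k hk => h k (by rw [pow_succ]; omega)

theorem testBit_windowOr_eq_false {X m i : ℕ} (hm : m ≠ 0)
    (h : ∀ k < m, X.testBit (i + k) = false) : (windowOr X m).testBit i = false := by
  have hle := Nat.log2_self_le hm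
  rw [windowOr, Nat.testBit_or, Nat.testBit_shiftRight, testBit_spreadBits_eq_false,
    testBit_spreadBits_eq_false, Bool.or_self]
  · intro k hk
    rw [show m - 2 ^ Nat.log2 m + i + k = i + (m - 2 ^ Nat.log2 m + k) by omega]
    exact h _ (by omega)
  · exact fun k hk => h k (by omega)

/-- No factor of period at most `124` and exponent above `7 / 3` starts in the first 62 bits
of `X`. -/
def noShortRepetition (X : ℕ) : Bool :=
  (List.range 125).all fun p => p == 0 ||
    windowOr (X ^^^ (X >>> p)) (4 * p / 3 + 1) % 2 ^ 62 == 2 ^ 62 - 1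

theorem exists_testBit_ne_of_noShortRepetition {X p r : ℕ} (hX : noShortRepetition X = true)
    (hp : 0 < p) (hp' : p < 125) (hr : r < 62) :
    ∃ k < 4 * p / 3 + 1, X.testBit (r + k) ≠ X.testBit (r + k + p) := by
  by_contra! h
  have hmask := List.all_eq_true.mp hX p (List.mem_range.mpr hp')
  rw [Bool.or_eq_true, beq_iff_eq, beq_iff_eq, or_iff_right hp.ne'] at hmask
  have hbit := congrArg (fun Y => Y.testBit r) hmask
  simp only [Nat.testBit_mod_two_pow, Nat.testBit_two_pow_sub_one, hr, decide_true,
    Bool.true_and] at hbit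
  rw [testBit_windowOr_eq_false (by omega)] at hbit
  · exact Bool.false_ne_true hbit
  · intro k hk
    rw [Nat.testBit_xor, Nat.testBit_shiftRight, h k hk, Nat.add_comm p, Bool.xor_self]

theorem blockListCode_noShortRepetition : ∀ a b : Fin 3, a ≠ b → ∀ c, b ≠ c → ∀ d, c ≠ d →
    ¬(a = c ∧ b = d) → ∀ e, d ≠ e → ¬(b = d ∧ c = e) → ∀ f, e ≠ f → ¬(c = e ∧ d = f) →
    noShortRepetition (blockListCode [a, b, c, d, e, f]) = true := by
  decide +kernel

theorem SquareFreeWord.not_eq_and_eq {α : Type*} {s : ℕ → α} (hs : SquareFreeWord s) (i : ℕ) :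
    ¬(s i = s (i + 2) ∧ s (i + 1) = s (i + 3)) := by
  rintro ⟨h0, h1⟩
  obtain ⟨k, hk, hne⟩ := hs 2 two_pos i
  interval_cases k
  exacts [hne h0, hne h1]

theorem uniformImage_blockMorphism_repetition {s : ℕ → Fin 3} (hs : SquareFreeWord s) {p : ℕ}
    (hp : 0 < p) (i : ℕ) : ∃ k < 4 * p / 3 + 1,
      uniformImage blockMorphism 62 s (i + k) ≠ uniformImage blockMorphism 62 s (i + k + p) := by
  have hi := Nat.div_add_mod i 62
  have hr := Nat.mod_lt i (show 0 < 62 by norm_num)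
  rcases Nat.lt_or_ge p 125 with hlt | hge
  · set b := i / 62
    obtain ⟨k, hk, hne⟩ := exists_testBit_ne_of_noShortRepetition
      (blockListCode_noShortRepetition _ _ (hs.ne_succ b) _ (hs.ne_succ (b + 1)) _
        (hs.ne_succ (b + 2)) (hs.not_eq_and_eq b) _ (hs.ne_succ (b + 3))
        (hs.not_eq_and_eq (b + 1)) _ (hs.ne_succ (b + 4)) (hs.not_eq_and_eq (b + 2))) hp hlt hr
    have hget : ∀ n < 372, _ := fun n hn => testBit_blockListCode s 6 b n hn
    refine ⟨k, hk, fun h => hne ?_⟩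
    refine (hget _ (by omega)).trans (Eq.trans ?_ (hget _ (by omega)).symm)
    rwa [← add_assoc, ← add_assoc, ← add_assoc, hi]
  · by_contra! hrun
    obtain ⟨d, rfl⟩ : 62 ∣ p :=
      dvd_of_uniformImage_eq_shift (by norm_num) blockMorphism_sync hs.ne_succ
        (by omega : 2 * 62 - 1 ≤ 4 * p / 3 + 1) hrun
    obtain ⟨j, hj, hne⟩ := hs d (by omega) (i / 62 + 1)
    refine hne (blockMorphism_injective fun k hk => ?_)
    have key := hrun (62 * (i / 62 + 1 + j) + k - i) (by omega)
    rw [show i + (62 * (i / 62 + 1 + j) + k - i) = 62 * (i / 62 + 1 + j) + k by omega,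
      show 62 * (i / 62 + 1 + j) + k + 62 * d = 62 * (i / 62 + 1 + j + d) + k by omega,
      uniformImage_mul_add _ (by norm_num), uniformImage_mul_add _ (by norm_num),
      Nat.div_eq_of_lt hk, Nat.mod_eq_of_lt hk] at key
    exact key

/-- The factors of length 13 of products of two distinct blocks, as numbers with the least
significant bit first. -/
def factorCodes : List ℕ :=
  [1234, 1241, 1446, 1613, 1686, 1689, 1741, 2409, 2451, 2469, 2483, 2892, 2893, 3226, 3227, 3282,
    3283, 3373, 3378, 3382, 3482, 4713, 4716, 4819, 4902, 4939, 4940, 4966, 5300, 5321, 5337, 5737,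
    5785, 5787, 6452, 6454, 6565, 6566, 6746, 6756, 6764, 6964]

theorem mem_factorCodes : ∀ a b : Fin 3, a ≠ b → ∀ r < 62,
    blockListCode [a, b] >>> r % 2 ^ 13 ∈ factorCodes := by
  decide +kernel

theorem xor_notMem_factorCodes : ∀ A ∈ factorCodes, A ^^^ (2 ^ 13 - 1) ∉ factorCodes := by
  decide +kernel

theorem exists_factorCode {s : ℕ → Fin 3} (hs : SquareFreeWord s) (i : ℕ) :
    ∃ A ∈ factorCodes, ∀ k, A.testBit k =
      (decide (k < 13) && uniformImage blockMorphism 62 s (i + k)) := by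
  have hi := Nat.div_add_mod i 62
  have hr := Nat.mod_lt i (show 0 < 62 by norm_num)
  refine ⟨_, mem_factorCodes _ _ (hs.ne_succ (i / 62)) (i % 62) hr, fun k => ?_⟩
  rw [Nat.testBit_mod_two_pow]
  by_cases hk : k < 13
  · have := testBit_blockListCode s 2 (i / 62) (i % 62 + k) (by omega)
    rw [← add_assoc, hi] at this
    rw [Nat.testBit_shiftRight, ← this]
    rfl
  · simp [hk]

theorem exists_not_complementary {s : ℕ → Fin 3} (hs : SquareFreeWord s) (i j : ℕ) :
    ∃ k < 13, uniformImage blockMorphism 62 s (j + k) ≠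
      !uniformImage blockMorphism 62 s (i + k) := by
  by_contra! h
  obtain ⟨A, hA, hAbit⟩ := exists_factorCode hs i
  obtain ⟨B, hB, hBbit⟩ := exists_factorCode hs j
  refine xor_notMem_factorCodes A hA ?_
  convert hB
  refine Nat.eq_of_testBit_eq fun k => ?_
  rw [Nat.testBit_xor, Nat.testBit_two_pow_sub_one, hAbit, hBbit]
  by_cases hk : k < 13
  · simp [hk, h k hk]
  · simp [hk]

theorem hasPeriod_minPeriod {α : Type*} {x : List α} (hx : x ≠ []) :
    HasPeriod x (minPeriod x) :=
  Nat.sInf_mem (s := {p | HasPeriod x p})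
    ⟨x.length, List.length_pos_of_ne_nil hx, fun i hi => by omega⟩

theorem getElem?_of_eq_map_range {α : Type*} {w : ℕ → α} {x : List α} {i : ℕ}
    (hx : x = (List.range x.length).map fun k => w (i + k)) {k : ℕ} (hk : k < x.length) :
    x[k]? = some (w (i + k)) := by
  rw [hx, List.getElem?_map, List.getElem?_range hk, Option.map_some]

theorem expo_le_of_forall_exists_ne {α : Type*} {w : ℕ → α}
    (hw : ∀ p, 0 < p → ∀ i, ∃ k < 4 * p / 3 + 1, w (i + k) ≠ w (i + k + p)) {x : List α}
    (hx : FactorN w x) (hne : x ≠ []) : expo x ≤ (7 : ℝ) / 3 := by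
  obtain ⟨i, hi⟩ := hx
  obtain ⟨hp, hper⟩ := hasPeriod_minPeriod hne
  rw [expo, div_le_div_iff₀ (by exact_mod_cast hp) (by norm_num)]
  suffices h : x.length * 3 ≤ 7 * minPeriod x by exact_mod_cast h
  by_contra! hlong
  obtain ⟨k, hk, hkne⟩ := hw _ hp i
  have := hper k (by omega)
  rw [getElem?_of_eq_map_range hi (by omega), getElem?_of_eq_map_range hi (by omega),
    Option.some_inj, ← add_assoc] at this
  exact hkne this

theorem stmt6 :
    ∃ w : ℕ → Bool,
      (∀ x : List Bool, FactorN w x → x ≠ [] → expo x ≤ (7 : ℝ) / 3) ∧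
      (∀ x : List Bool, 13 ≤ x.length → ¬(FactorN w x ∧ FactorN w (comp x))) := by
  refine ⟨uniformImage blockMorphism 62 leechWord, fun x hx hne => expo_le_of_forall_exists_ne
    (fun p hp i => uniformImage_blockMorphism_repetition leechWord_squareFree hp i) hx hne, ?_⟩
  rintro x hlen ⟨⟨i, hi⟩, ⟨j, hj⟩⟩
  obtain ⟨k, hk, hne⟩ := exists_not_complementary leechWord_squareFree i j
  have hjk := getElem?_of_eq_map_range hj (k := k) (by rw [comp, List.length_map]; omega)
  rw [comp, List.getElem?_map, getElem?_of_eq_map_range hi (by omega), Option.map_some,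
    Option.some_inj] at hjk
  exact hne hjk.symm
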